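/- Let P be a polynomial with complex coefficients of degree n, let a be a complex number with |a| ≤ 1, and let α, β be complex numbers with |α| ≤ 1 and |β| ≤ 1. Then for every real R ≥ 1 and every complex z with |z| ≥ 1, |S̃_a[P](Rz) − α·S̃_a[P](z) + β(((R+1)/2)^n − |α|)·S̃_a[P](z)| ≤ |R^n − α + β(((R+1)/2)^n − |α|)| · n|z|^(n−1) · max_{|w|=1} |P(w)|. -/

import Mathlib

open Polynomial

/-- The modified Smirnov operator: S̃ₐ[P](z) = (1+az)·P′(z) − n·a·P(z). -/
noncomputable def smirnov (n : ℕ) (a : ℂ) (P : Polynomial ℂ) (z : ℂ) : ℂ :=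
  (1 + a * z) * P.derivative.eval z - (n : ℂ) * a * P.eval z

/-- The maximum of ‖P‖ on the unit circle. -/
noncomputable def maxCircle (P : Polynomial ℂ) : ℝ :=
  sSup {y : ℝ | ∃ w : ℂ, ‖w‖ = 1 ∧ y = ‖P.eval w‖}

/-! ### Polynomials bounded on the unit circle -/

/-- A polynomial of degree at most `m` bounded by `M` on the unit circle is the reflection of a
polynomial bounded by `M` on the closed unit disc. -/
lemma norm_eval_reflect_le {Q : ℂ[X]} {m : ℕ} {M : ℝ} (hQ : Q.natDegree ≤ m)
    (hM : ∀ w : ℂ, ‖w‖ = 1 → ‖Q.eval w‖ ≤ M) {z : ℂ} (hz : ‖z‖ ≤ 1) :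
    ‖(reflect m Q).eval z‖ ≤ M := by
  refine Complex.norm_le_of_forall_mem_frontier_norm_le (U := Metric.ball (0 : ℂ) 1)
    (f := fun x => (reflect m Q).eval x) Metric.isBounded_ball
    (reflect m Q).differentiable.diffContOnCl (fun w hw => ?_) ?_
  · rw [frontier_ball _ one_ne_zero, mem_sphere_zero_iff_norm] at hw
    have hw0 : w ≠ 0 := by rintro rfl; simp at hw
    let _ : Invertible w⁻¹ := invertibleOfNonzero (inv_ne_zero hw0)
    have h := eval₂_reflect_mul_pow (RingHom.id ℂ) w⁻¹ m Q hQ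
    simp only [invOf_eq_inv, inv_inv] at h
    have h2 := congrArg norm h
    rw [norm_mul, norm_pow, norm_inv, hw, inv_one, one_pow, mul_one] at h2
    change ‖(reflect m Q).eval w‖ = ‖Q.eval w⁻¹‖ at h2
    rw [h2]
    exact hM _ (by simp [hw])
  · rw [closure_ball _ one_ne_zero]
    simpa using hz

lemma norm_eval_le_mul_pow {Q : ℂ[X]} {m : ℕ} {M : ℝ} (hQ : Q.natDegree ≤ m)
    (hM : ∀ w : ℂ, ‖w‖ = 1 → ‖Q.eval w‖ ≤ M) {z : ℂ} (hz : 1 ≤ ‖z‖) :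
    ‖Q.eval z‖ ≤ M * ‖z‖ ^ m := by
  have hz0 : z ≠ 0 := norm_pos_iff.1 (by linarith)
  let _ : Invertible z := invertibleOfNonzero hz0
  have h := eval₂_reflect_mul_pow (RingHom.id ℂ) z m Q hQ
  simp only [invOf_eq_inv] at h
  change (reflect m Q).eval z⁻¹ * z ^ m = Q.eval z at h
  rw [← h, norm_mul, norm_pow]
  gcongr
  exact norm_eval_reflect_le hQ hM (by rw [norm_inv]; exact inv_le_one_of_one_le₀ hz)

lemma norm_coeff_le {Q : ℂ[X]} {m : ℕ} {M : ℝ} (hQ : Q.natDegree ≤ m)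
    (hM : ∀ w : ℂ, ‖w‖ = 1 → ‖Q.eval w‖ ≤ M) : ‖Q.coeff m‖ ≤ M := by
  have h := norm_eval_reflect_le hQ hM (z := 0) (by simp)
  rwa [← coeff_zero_eq_eval_zero, coeff_reflect, revAt_zero] at h

section Comparison

variable {Q : ℂ[X]} {m : ℕ} {M : ℝ} {c : ℂ}

lemma eval_C_mul_X_pow_sub_ne_zero (hQ : Q.natDegree ≤ m)
    (hM : ∀ w : ℂ, ‖w‖ = 1 → ‖Q.eval w‖ ≤ M) (hc : M < ‖c‖) {z : ℂ} (hz : 1 ≤ ‖z‖) :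
    (C c * X ^ m - Q).eval z ≠ 0 := by
  intro h
  have h1 := norm_eval_le_mul_pow hQ hM hz
  rw [eval_sub, eval_C_mul, eval_pow, eval_X, sub_eq_zero] at h
  rw [← h, norm_mul, norm_pow] at h1
  have : 0 < ‖z‖ ^ m := by positivity
  nlinarith

lemma natDegree_C_mul_X_pow_sub (hQ : Q.natDegree ≤ m)
    (hM : ∀ w : ℂ, ‖w‖ = 1 → ‖Q.eval w‖ ≤ M) (hc : M < ‖c‖) :
    (C c * X ^ m - Q).natDegree = m := by
  refine natDegree_eq_of_le_of_coeff_ne_zero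
    ((natDegree_sub_le _ _).trans (max_le (natDegree_C_mul_X_pow_le _ _) hQ)) ?_
  rw [coeff_sub, coeff_C_mul, coeff_X_pow_self, mul_one, sub_ne_zero]
  rintro rfl
  exact absurd (norm_coeff_le hQ hM) (not_le.2 hc)

lemma norm_lt_one_of_mem_roots (hQ : Q.natDegree ≤ m)
    (hM : ∀ w : ℂ, ‖w‖ = 1 → ‖Q.eval w‖ ≤ M) (hc : M < ‖c‖) {x : ℂ}
    (hx : x ∈ (C c * X ^ m - Q).roots) : ‖x‖ < 1 := by
  by_contra! h
  exact eval_C_mul_X_pow_sub_ne_zero hQ hM hc h (isRoot_of_mem_roots hx)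

end Comparison

/-! ### Growth of polynomials with all zeros in the unit disc -/

lemma mul_norm_sub_le_norm_mul_sub {R : ℝ} (hR : 1 ≤ R) {z x : ℂ} (hx : ‖x‖ ≤ ‖z‖) :
    (R + 1) / 2 * ‖z - x‖ ≤ ‖(R : ℂ) * z - x‖ := by
  refine le_of_sq_le_sq ?_ (norm_nonneg _)
  rw [mul_pow, ← Complex.normSq_eq_norm_sq, ← Complex.normSq_eq_norm_sq]
  have h := pow_le_pow_left₀ (norm_nonneg x) hx 2
  rw [← Complex.normSq_eq_norm_sq, ← Complex.normSq_eq_norm_sq] at h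
  simp only [Complex.normSq_apply, Complex.sub_re, Complex.sub_im, Complex.re_ofReal_mul,
    Complex.im_ofReal_mul] at h ⊢
  have h1 : 0 ≤ (R ^ 2 - 1) / 2 * (z.re * z.re + z.im * z.im - (x.re * x.re + x.im * x.im)) :=
    mul_nonneg (by nlinarith) (by linarith)
  nlinarith [sq_nonneg ((R - 1) * (z.re + x.re)), sq_nonneg ((R - 1) * (z.im + x.im))]

lemma pow_card_mul_norm_prod_le {R : ℝ} (hR : 1 ≤ R) {z : ℂ} (s : Multiset ℂ)
    (hs : ∀ x ∈ s, ‖x‖ ≤ ‖z‖) :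
    ((R + 1) / 2) ^ s.card * ‖(s.map (z - ·)).prod‖ ≤ ‖(s.map ((R : ℂ) * z - ·)).prod‖ := by
  induction s using Multiset.induction_on with
  | empty => simp
  | cons x s ih =>
    have h1 := ih fun y hy => hs y (Multiset.mem_cons_of_mem hy)
    have h2 := mul_norm_sub_le_norm_mul_sub hR (hs x (Multiset.mem_cons_self x s))
    simp only [Multiset.map_cons, Multiset.prod_cons, Multiset.card_cons, norm_mul]
    calc _ = ((R + 1) / 2 * ‖z - x‖) * (((R + 1) / 2) ^ s.card * ‖(s.map (z - ·)).prod‖) := by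
          ring
      _ ≤ _ := mul_le_mul h2 h1 (by positivity) (norm_nonneg _)

lemma pow_natDegree_mul_norm_eval_le {R : ℝ} (hR : 1 ≤ R) {z : ℂ} (G : ℂ[X])
    (hG : ∀ x ∈ G.roots, ‖x‖ ≤ ‖z‖) :
    ((R + 1) / 2) ^ G.natDegree * ‖G.eval z‖ ≤ ‖G.eval ((R : ℂ) * z)‖ := by
  have hs := IsAlgClosed.splits G
  rw [hs.eval_eq_prod_roots z, hs.eval_eq_prod_roots, hs.natDegree_eq_card_roots, norm_mul,
    norm_mul, mul_left_comm]
  gcongr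
  exact pow_card_mul_norm_prod_le hR _ hG

lemma norm_eval_mul_sub_le {Q : ℂ[X]} {m : ℕ} {M : ℝ} (hQ : Q.natDegree ≤ m)
    (hM : ∀ w : ℂ, ‖w‖ = 1 → ‖Q.eval w‖ ≤ M) {R : ℝ} (hR : 1 ≤ R) {z : ℂ} (hz : 1 ≤ ‖z‖)
    {w : ℂ} (hw : ‖w‖ < ((R + 1) / 2) ^ m) :
    ‖Q.eval ((R : ℂ) * z) - w * Q.eval z‖ ≤ M * (‖(R : ℂ) ^ m - w‖ * ‖z‖ ^ m) := by
  have hz0 : z ≠ 0 := norm_pos_iff.1 (by linarith)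
  have hRw : (R : ℂ) ^ m - w ≠ 0 := by
    rw [sub_ne_zero]
    rintro rfl
    rw [norm_pow, Complex.norm_of_nonneg (by linarith)] at hw
    exact absurd (pow_le_pow_left₀ (by linarith) (by linarith : (R + 1) / 2 ≤ R) m) (not_le.2 hw)
  have hd : ((R : ℂ) ^ m - w) * z ^ m ≠ 0 := mul_ne_zero hRw (pow_ne_zero _ hz0)
  by_contra! h
  obtain ⟨c, hc⟩ : ∃ c, c = (Q.eval ((R : ℂ) * z) - w * Q.eval z) / (((R : ℂ) ^ m - w) * z ^ m) :=
    ⟨_, rfl⟩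
  have hcM : M < ‖c‖ := by
    rw [hc, norm_div, lt_div_iff₀ (norm_pos_iff.2 hd), norm_mul, norm_pow]
    exact h
  rw [eq_div_iff hd] at hc
  have hG := pow_natDegree_mul_norm_eval_le hR (z := z) (C c * X ^ m - Q)
    fun x hx => (norm_lt_one_of_mem_roots hQ hM hcM hx).le.trans hz
  have hne := norm_pos_iff.2 (eval_C_mul_X_pow_sub_ne_zero hQ hM hcM hz)
  have heq : (C c * X ^ m - Q).eval ((R : ℂ) * z) = w * (C c * X ^ m - Q).eval z := by
    simp only [eval_sub, eval_C_mul, eval_pow, eval_X]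
    linear_combination hc
  rw [natDegree_C_mul_X_pow_sub hQ hM hcM, heq, norm_mul] at hG
  exact absurd (le_of_mul_le_mul_right hG hne) (not_le.2 hw)

/-! ### The Smirnov operator on the unit circle -/

lemma half_lt_re_div_sub {z x : ℂ} (hx : ‖x‖ < ‖z‖) : 1 / 2 < (z / (z - x)).re := by
  have hne : z - x ≠ 0 := by
    rw [sub_ne_zero]
    rintro rfl
    exact lt_irrefl _ hx
  have hpos := Complex.normSq_pos.2 hne
  have h := pow_lt_pow_left₀ hx (norm_nonneg x) two_ne_zero
  rw [← Complex.normSq_eq_norm_sq, ← Complex.normSq_eq_norm_sq] at h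
  rw [Complex.div_re, ← add_div, lt_div_iff₀ hpos]
  simp only [Complex.normSq_apply, Complex.sub_re, Complex.sub_im] at h ⊢
  nlinarith

lemma card_div_two_lt_re_sum {z : ℂ} (s : Multiset ℂ) (hs : ∀ x ∈ s, ‖x‖ < ‖z‖) (h0 : s ≠ 0) :
    (s.card : ℝ) / 2 < ((s.map fun x => z / (z - x)).sum).re := by
  induction s using Multiset.induction_on with
  | empty => exact absurd rfl h0
  | cons x s ih =>
    have h2 := half_lt_re_div_sub (hs x (Multiset.mem_cons_self x s))
    simp only [Multiset.map_cons, Multiset.sum_cons, Multiset.card_cons, Complex.add_re]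
    push_cast
    rcases eq_or_ne s 0 with rfl | h
    · simpa using h2
    · linarith [ih (fun y hy => hs y (Multiset.mem_cons_of_mem hy)) h]

lemma norm_natDegree_mul_eval_sub_lt (F : ℂ[X]) (hF : F.natDegree ≠ 0) {z : ℂ}
    (hr : ∀ x ∈ F.roots, ‖x‖ < ‖z‖) :
    ‖(F.natDegree : ℂ) * F.eval z - z * F.derivative.eval z‖ < ‖z * F.derivative.eval z‖ := by
  have hs := IsAlgClosed.splits F
  have hF0 : F ≠ 0 := by rintro rfl; simp at hF
  have hne : F.eval z ≠ 0 := fun h => lt_irrefl _ (hr z ((mem_roots hF0).2 h))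
  have hsum := card_div_two_lt_re_sum F.roots hr (by
    rw [← Multiset.card_pos, ← hs.natDegree_eq_card_roots]; omega)
  have hq : z * F.derivative.eval z
      = (F.roots.map fun x => z / (z - x)).sum * F.eval z := by
    have h := hs.eval_derivative_div_eval_of_ne_zero hne
    rw [div_eq_iff hne] at h
    rw [h, ← mul_assoc, ← Multiset.sum_map_mul_left]
    simp only [mul_one_div]
  rw [← hs.natDegree_eq_card_roots] at hsum
  rw [hq, ← sub_mul, norm_mul, norm_mul]
  refine mul_lt_mul_of_pos_right ?_ (norm_pos_iff.2 hne)
  have hn : (0 : ℝ) < F.natDegree := by exact_mod_cast Nat.pos_of_ne_zero hF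
  refine lt_of_pow_lt_pow_left₀ 2 (norm_nonneg _) ?_
  rw [← Complex.normSq_eq_norm_sq, ← Complex.normSq_eq_norm_sq]
  simp only [Complex.normSq_apply, Complex.sub_re, Complex.sub_im, Complex.natCast_re,
    Complex.natCast_im]
  nlinarith

lemma smirnov_C_mul_X_pow_sub (n : ℕ) (a c : ℂ) (P : ℂ[X]) (z : ℂ) :
    smirnov (n + 1) a (C c * X ^ (n + 1) - P) z
      = c * ((n + 1 : ℕ) * z ^ n) - smirnov (n + 1) a P z := by
  simp only [smirnov, derivative_sub, derivative_C_mul, derivative_X_pow, eval_sub, eval_mul,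
    eval_C, eval_pow, eval_X, Nat.add_sub_cancel]
  ring

lemma norm_smirnov_le {n : ℕ} {P : ℂ[X]} {M : ℝ} (hP : P.natDegree ≤ n + 1)
    (hM : ∀ w : ℂ, ‖w‖ = 1 → ‖P.eval w‖ ≤ M) {a : ℂ} (ha : ‖a‖ ≤ 1) {z : ℂ} (hz : ‖z‖ = 1) :
    ‖smirnov (n + 1) a P z‖ ≤ (n + 1 : ℕ) * M := by
  have hz0 : z ≠ 0 := by rintro rfl; simp at hz
  have hn : ((n + 1 : ℕ) : ℂ) ≠ 0 := Nat.cast_ne_zero.2 n.succ_ne_zero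
  have hd : ((n + 1 : ℕ) : ℂ) * z ^ n ≠ 0 := mul_ne_zero hn (pow_ne_zero _ hz0)
  by_contra! h
  obtain ⟨c, hc⟩ : ∃ c, c = smirnov (n + 1) a P z / (((n + 1 : ℕ) : ℂ) * z ^ n) := ⟨_, rfl⟩
  have hcM : M < ‖c‖ := by
    rw [hc, norm_div, lt_div_iff₀ (norm_pos_iff.2 hd), norm_mul, norm_pow, hz, one_pow, mul_one,
      Complex.norm_natCast, mul_comm]
    exact h
  rw [eq_div_iff hd] at hc
  have h0 := smirnov_C_mul_X_pow_sub n a c P z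
  rw [hc, sub_self] at h0
  have hdeg := natDegree_C_mul_X_pow_sub hP hM hcM
  have hlt := norm_natDegree_mul_eval_sub_lt (C c * X ^ (n + 1) - P) (by omega) (z := z)
    fun x hx => by rw [hz]; exact norm_lt_one_of_mem_roots hP hM hcM hx
  rw [hdeg, norm_mul z, hz, one_mul] at hlt
  generalize C c * X ^ (n + 1) - P = F at h0 hlt
  have h1 : F.derivative.eval z
      = a * (((n + 1 : ℕ) : ℂ) * F.eval z - z * F.derivative.eval z) := by
    rw [smirnov] at h0
    linear_combination h0
  have h2 := congrArg norm h1
  rw [norm_mul] at h2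
  nlinarith [norm_nonneg (((n + 1 : ℕ) : ℂ) * F.eval z - z * F.derivative.eval z)]

/-- The Smirnov operator as a polynomial. -/
noncomputable def smirnovPoly (n : ℕ) (a : ℂ) (P : ℂ[X]) : ℂ[X] :=
  (1 + C a * X) * derivative P - C ((n : ℂ) * a) * P

lemma eval_smirnovPoly (n : ℕ) (a : ℂ) (P : ℂ[X]) (z : ℂ) :
    (smirnovPoly n a P).eval z = smirnov n a P z := by
  simp [smirnovPoly, smirnov]

lemma natDegree_smirnovPoly_le {n : ℕ} (a : ℂ) {P : ℂ[X]} (hP : P.natDegree ≤ n + 1) :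
    (smirnovPoly (n + 1) a P).natDegree ≤ n := by
  rw [natDegree_le_iff_coeff_eq_zero]
  intro N hN
  obtain ⟨k, rfl⟩ : ∃ k, N = k + 1 := ⟨N - 1, by omega⟩
  have h2 : P.coeff (k + 1 + 1) = 0 := coeff_eq_zero_of_natDegree_lt (by omega)
  simp only [smirnovPoly, add_mul, one_mul, coeff_sub, coeff_add, mul_assoc, coeff_C_mul,
    coeff_X_mul, coeff_derivative, h2]
  rcases Nat.lt_or_ge n k with hk | hk
  · simp [coeff_eq_zero_of_natDegree_lt (show P.natDegree < k + 1 by omega)]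
  · obtain rfl : n = k := by omega
    push_cast
    ring

/-! ### Rescaling the comparison inequality -/

lemma exists_norm_add_mul_eq (k : ℝ) (hk : 0 ≤ k) (A B : ℂ) :
    ∃ η : ℂ, ‖η‖ = 1 ∧ ‖A + k * η * B‖ = ‖A‖ + k * ‖B‖ := by
  refine ⟨Complex.exp ((A.arg - B.arg : ℝ) * Complex.I), Complex.norm_exp_ofReal_mul_I _, ?_⟩
  have h : A + k * Complex.exp ((A.arg - B.arg : ℝ) * Complex.I) * B
      = ((‖A‖ + k * ‖B‖ : ℝ) : ℂ) * Complex.exp (A.arg * Complex.I) := by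
    have h2 : Complex.exp ((A.arg - B.arg : ℝ) * Complex.I) * Complex.exp (B.arg * Complex.I)
        = Complex.exp (A.arg * Complex.I) := by
      rw [← Complex.exp_add]
      congr 1
      push_cast
      ring
    have hA := Complex.norm_mul_exp_arg_mul_I A
    have hB := Complex.norm_mul_exp_arg_mul_I B
    push_cast at h2 ⊢
    linear_combination (k : ℂ) * ‖B‖ * h2 - hA
      - k * Complex.exp (((A.arg : ℂ) - B.arg) * Complex.I) * hB
  rw [h, norm_mul, Complex.norm_exp_ofReal_mul_I, mul_one, Complex.norm_of_nonneg (by positivity)]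

/-- If `(U - W * v) / (1 - W)` stays in the disc of radius `N` on the circle `‖W‖ = k`, then the
disc which is the image of that circle lies in the disc of radius `N`. -/
lemma norm_add_mul_norm_le {U v : ℂ} {k N : ℝ} (hk0 : 0 ≤ k) (hk1 : k < 1)
    (h : ∀ W : ℂ, ‖W‖ = k → ‖U - W * v‖ ≤ N * ‖1 - W‖) :
    ‖U - (k : ℂ) ^ 2 * v‖ + k * ‖U - v‖ ≤ N * (1 - k ^ 2) := by
  obtain ⟨η, hη, hAB⟩ := exists_norm_add_mul_eq k hk0 (U - (k : ℂ) ^ 2 * v) (U - v)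
  rw [← hAB]
  have hconj : η * (starRingEnd ℂ) η = 1 := by
    rw [Complex.mul_conj, Complex.normSq_eq_norm_sq, hη]; simp
  have hd : 1 + (k : ℂ) * η ≠ 0 := by
    intro h0
    have h1 : (k : ℂ) * η = -1 := by linear_combination h0
    have h2 := congrArg norm h1
    rw [norm_mul, hη, Complex.norm_of_nonneg hk0, norm_neg, norm_one] at h2
    linarith
  obtain ⟨W, hW⟩ : ∃ W : ℂ, W = ((k : ℂ) * η + (k : ℂ) ^ 2) / (1 + k * η) := ⟨_, rfl⟩
  rw [eq_div_iff hd] at hW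
  have hWk : ‖W‖ = k := by
    have h1 : W * (1 + k * η) = k * (η * (starRingEnd ℂ) (1 + k * η)) := by
      rw [hW, map_add, map_mul, map_one, Complex.conj_ofReal]
      linear_combination (-(k : ℂ) ^ 2) * hconj
    have h2 := congrArg norm h1
    rw [norm_mul, norm_mul, norm_mul, hη, one_mul, RCLike.norm_conj,
      Complex.norm_of_nonneg hk0] at h2
    exact mul_right_cancel₀ (norm_ne_zero_iff.2 hd) h2
  have hk2 : 0 ≤ 1 - k ^ 2 := by nlinarith
  have e1 : U - (k : ℂ) ^ 2 * v + k * η * (U - v) = (U - W * v) * (1 + k * η) := by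
    linear_combination v * hW
  have e2 : (1 - W) * (1 + k * η) = ((1 - k ^ 2 : ℝ) : ℂ) := by
    push_cast
    linear_combination -hW
  have e3 := congrArg norm e2
  rw [norm_mul, Complex.norm_of_nonneg hk2] at e3
  rw [e1, norm_mul, ← e3, ← mul_assoc]
  gcongr
  exact h W hWk

lemma norm_sub_mul_le_mul_norm_one_sub {U v W : ℂ} {k N : ℝ} (hk1 : k < 1) (hW : ‖W‖ = k)
    (h : ‖U - (k : ℂ) ^ 2 * v‖ + k * ‖U - v‖ ≤ N * (1 - k ^ 2)) :
    ‖U - W * v‖ ≤ N * ‖1 - W‖ := by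
  have hk0 : 0 ≤ k := hW ▸ norm_nonneg W
  have hk2 : 0 < 1 - k ^ 2 := by nlinarith
  have hWc : W * (starRingEnd ℂ) W = (k : ℂ) ^ 2 := by
    rw [Complex.mul_conj, Complex.normSq_eq_norm_sq, hW]; push_cast; rfl
  have e1 : ‖W - (k : ℂ) ^ 2‖ = k * ‖1 - W‖ := by
    have : W - (k : ℂ) ^ 2 = W * (starRingEnd ℂ) (1 - W) := by
      rw [← hWc, map_sub, map_one]; ring
    rw [this, norm_mul, RCLike.norm_conj, hW]
  have e2 : ((1 - k ^ 2 : ℝ) : ℂ) * (U - W * v)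
      = (1 - W) * (U - (k : ℂ) ^ 2 * v) + (W - (k : ℂ) ^ 2) * (U - v) := by
    push_cast
    ring
  have e3 := congrArg norm e2
  rw [norm_mul, Complex.norm_of_nonneg hk2.le] at e3
  refine le_of_mul_le_mul_left ?_ hk2
  rw [e3]
  refine (norm_add_le _ _).trans ?_
  rw [norm_mul, norm_mul, e1]
  nlinarith [mul_le_mul_of_nonneg_left h (norm_nonneg (1 - W))]

lemma norm_add_mul_norm_le_of_rescale {U v : ℂ} {k t N : ℝ} (hk0 : 0 ≤ k) (hk1 : k < 1)
    (ht0 : 1 / 2 ≤ t) (ht1 : t ≤ 1)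
    (h : ‖U - (k : ℂ) ^ 2 * v‖ + k * ‖U - v‖ ≤ N * (1 - k ^ 2)) :
    ‖((2 * t - 1 : ℝ) : ℂ) * U - ((k * t : ℝ) : ℂ) ^ 2 * v‖
      + k * t * ‖((2 * t - 1 : ℝ) : ℂ) * U - v‖ ≤ N * (1 - (k * t) ^ 2) := by
  have hk2 : 0 < 1 - k ^ 2 := by nlinarith
  have hkt : k * t < 1 := by nlinarith
  have hkt0 : 0 ≤ k * t := by positivity
  have hs : 0 ≤ 1 - (2 * t - 1) * k ^ 2 := by nlinarith
  have eA : ((1 - k ^ 2 : ℝ) : ℂ) * (((2 * t - 1 : ℝ) : ℂ) * U - ((k * t : ℝ) : ℂ) ^ 2 * v)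
      = ((2 * t - 1 - (k * t) ^ 2 : ℝ) : ℂ) * (U - (k : ℂ) ^ 2 * v)
        + ((k ^ 2 * (1 - t) ^ 2 : ℝ) : ℂ) * (U - v) := by
    push_cast
    ring
  have eB : ((1 - k ^ 2 : ℝ) : ℂ) * (((2 * t - 1 : ℝ) : ℂ) * U - v)
      = ((1 - (2 * t - 1) * k ^ 2 : ℝ) : ℂ) * (U - v)
        - ((2 * (1 - t) : ℝ) : ℂ) * (U - (k : ℂ) ^ 2 * v) := by
    push_cast
    ring
  have nA := congrArg norm eA
  have nB := congrArg norm eB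
  rw [norm_mul, Complex.norm_of_nonneg hk2.le] at nA nB
  have iA := nA.le.trans (norm_add_le _ _)
  have iB := nB.le.trans (norm_sub_le _ _)
  rw [norm_mul, norm_mul, Complex.norm_real, Real.norm_eq_abs,
    Complex.norm_of_nonneg (by positivity)] at iA
  rw [norm_mul, norm_mul, Complex.norm_of_nonneg hs, Complex.norm_of_nonneg (by linarith)] at iB
  have cA : |2 * t - 1 - (k * t) ^ 2| + k * t * (2 * (1 - t)) ≤ 1 - (k * t) ^ 2 := by
    rcases abs_cases (2 * t - 1 - (k * t) ^ 2) with ⟨h1, -⟩ | ⟨h1, -⟩ <;> rw [h1]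
    · nlinarith
    · nlinarith [mul_nonneg (mul_nonneg hkt0 (by linarith : 0 ≤ t)) (by linarith : 0 ≤ 1 - k),
        mul_nonneg (by linarith : 0 ≤ t) (by linarith : 0 ≤ 1 - k)]
  have cB : k ^ 2 * (1 - t) ^ 2 + k * t * (1 - (2 * t - 1) * k ^ 2)
      ≤ (1 - (k * t) ^ 2) * k := by
    have h1 : 0 ≤ k * (1 - t) * (1 - k * (1 - t * (1 - k))) := by
      have : k * (1 - t * (1 - k)) ≤ 1 := by
        have h3 : 0 ≤ t * (1 - k) := mul_nonneg (by linarith) (by linarith)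
        nlinarith
      exact mul_nonneg (mul_nonneg hk0 (by linarith)) (by linarith)
    nlinarith
  have jA := mul_le_mul_of_nonneg_right cA (norm_nonneg (U - (k : ℂ) ^ 2 * v))
  have jB := mul_le_mul_of_nonneg_right cB (norm_nonneg (U - v))
  have iB' := mul_le_mul_of_nonneg_left iB hkt0
  have h' := mul_le_mul_of_nonneg_left h (by nlinarith : 0 ≤ 1 - (k * t) ^ 2)
  refine le_of_mul_le_mul_left ?_ hk2
  linarith

/-- The comparison inequality for a polynomial of degree at most `m`, with the exponent `m` replaced
by `m + 1` both in the range of `w` and in the factor `‖R ^ m - w‖`. -/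
lemma norm_eval_mul_sub_le_succ {Q : ℂ[X]} {m : ℕ} {M : ℝ} (hQ : Q.natDegree ≤ m)
    (hM : ∀ w : ℂ, ‖w‖ = 1 → ‖Q.eval w‖ ≤ M) {R : ℝ} (hR : 1 ≤ R) {z : ℂ} (hz : 1 ≤ ‖z‖)
    {w : ℂ} (hw : ‖w‖ < ((R + 1) / 2) ^ (m + 1)) :
    ‖Q.eval ((R : ℂ) * z) - w * Q.eval z‖ ≤ M * (‖(R : ℂ) ^ (m + 1) - w‖ * ‖z‖ ^ m) := by
  have hR0 : 0 < R := by linarith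
  have hRC : (R : ℂ) ≠ 0 := Complex.ofReal_ne_zero.2 hR0.ne'
  have hz0 : z ≠ 0 := norm_pos_iff.1 (by linarith)
  have hnR : ‖(R : ℂ)‖ = R := Complex.norm_of_nonneg hR0.le
  have hc0 : 0 < (R + 1) / 2 := by linarith
  have hcR : ((R + 1) / 2) ^ m ≤ R ^ m := pow_le_pow_left₀ hc0.le (by linarith) m
  obtain ⟨k, hk⟩ : ∃ k, k = ‖w‖ / ((R + 1) / 2 * R ^ m) := ⟨_, rfl⟩
  have hk0 : 0 ≤ k := by rw [hk]; positivity
  have hkc : k * R ^ m < ((R + 1) / 2) ^ m := by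
    have : k * R ^ m = ‖w‖ / ((R + 1) / 2) := by rw [hk]; field_simp
    rw [this, div_lt_iff₀ hc0, ← pow_succ]
    exact hw
  have hk1 : k < 1 := by
    have : 0 < R ^ m := by positivity
    nlinarith
  have key : ∀ W : ℂ, ‖W‖ = k →
      ‖Q.eval ((R : ℂ) * z) / ((R : ℂ) * z) ^ m - W * (Q.eval z / z ^ m)‖ ≤ M * ‖1 - W‖ := by
    intro W hW
    have h := norm_eval_mul_sub_le hQ hM hR hz (w := W * (R : ℂ) ^ m)
      (by rw [norm_mul, norm_pow, hnR, hW]; exact hkc)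
    have e1 : Q.eval ((R : ℂ) * z) - W * (R : ℂ) ^ m * Q.eval z
        = (Q.eval ((R : ℂ) * z) / ((R : ℂ) * z) ^ m - W * (Q.eval z / z ^ m))
          * ((R : ℂ) * z) ^ m := by
      rw [mul_pow]
      field_simp
    have e2 : (R : ℂ) ^ m - W * (R : ℂ) ^ m = (1 - W) * (R : ℂ) ^ m := by ring
    rw [e1, e2, norm_mul, norm_mul, mul_assoc, ← norm_pow z, ← norm_mul ((R : ℂ) ^ m),
      ← mul_pow, ← mul_assoc] at h
    exact le_of_mul_le_mul_right h (norm_pos_iff.2 (pow_ne_zero _ (mul_ne_zero hRC hz0)))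
  have ht1 : (R + 1) / 2 / R ≤ 1 := by rw [div_le_one hR0]; linarith
  have ht0 : 1 / 2 ≤ (R + 1) / 2 / R := by rw [le_div_iff₀ hR0]; linarith
  have hs := norm_add_mul_norm_le_of_rescale hk0 hk1 ht0 ht1 (norm_add_mul_norm_le hk0 hk1 key)
  have hW : ‖w / (R : ℂ) ^ (m + 1)‖ = k * ((R + 1) / 2 / R) := by
    rw [norm_div, norm_pow, hnR, hk, pow_succ]
    field_simp
  have hfin := norm_sub_mul_le_mul_norm_one_sub (by nlinarith) hW hs
  have e0 : 2 * ((R + 1) / 2 / R) - 1 = R⁻¹ := by field_simp; ring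
  have e1 : Q.eval ((R : ℂ) * z) - w * Q.eval z
      = (((2 * ((R + 1) / 2 / R) - 1 : ℝ) : ℂ) * (Q.eval ((R : ℂ) * z) / ((R : ℂ) * z) ^ m)
          - w / (R : ℂ) ^ (m + 1) * (Q.eval z / z ^ m)) * ((R : ℂ) ^ (m + 1) * z ^ m) := by
    rw [e0, mul_pow, pow_succ]
    push_cast
    field_simp
  have e2 : (R : ℂ) ^ (m + 1) - w = (1 - w / (R : ℂ) ^ (m + 1)) * (R : ℂ) ^ (m + 1) := by
    field_simp
  rw [e1, e2, norm_mul, norm_mul (1 - w / (R : ℂ) ^ (m + 1)), mul_assoc ‖1 - _‖, ← norm_pow z,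
    ← norm_mul ((R : ℂ) ^ (m + 1)), ← mul_assoc M]
  exact mul_le_mul_of_nonneg_right hfin (norm_nonneg _)

lemma norm_eval_mul_sub_le_succ_of_le {Q : ℂ[X]} {m : ℕ} {M : ℝ} (hQ : Q.natDegree ≤ m)
    (hM : ∀ w : ℂ, ‖w‖ = 1 → ‖Q.eval w‖ ≤ M) {R : ℝ} (hR : 1 ≤ R) {z : ℂ} (hz : 1 ≤ ‖z‖)
    {w : ℂ} (hw : ‖w‖ ≤ ((R + 1) / 2) ^ (m + 1)) :
    ‖Q.eval ((R : ℂ) * z) - w * Q.eval z‖ ≤ M * (‖(R : ℂ) ^ (m + 1) - w‖ * ‖z‖ ^ m) := by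
  have hcl : IsClosed {w : ℂ | ‖Q.eval ((R : ℂ) * z) - w * Q.eval z‖
      ≤ M * (‖(R : ℂ) ^ (m + 1) - w‖ * ‖z‖ ^ m)} :=
    isClosed_le (by fun_prop) (by fun_prop)
  have hsub := hcl.closure_subset_iff.2 fun w (hw : w ∈ Metric.ball 0 (((R + 1) / 2) ^ (m + 1))) =>
    norm_eval_mul_sub_le_succ hQ hM hR hz (by simpa using hw)
  have hpos : 0 < (R + 1) / 2 := by linarith
  rw [closure_ball _ (by positivity)] at hsub
  exact hsub (by simpa using hw)

lemma norm_eval_le_maxCircle (P : ℂ[X]) {w : ℂ} (hw : ‖w‖ = 1) : ‖P.eval w‖ ≤ maxCircle P := by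
  refine le_csSup ?_ ⟨w, hw, rfl⟩
  refine ((isCompact_sphere (0 : ℂ) 1).bddAbove_image
    (f := fun w => ‖P.eval w‖) (by fun_prop)).mono ?_
  rintro _ ⟨w, hw, rfl⟩
  exact ⟨w, by simpa using hw, rfl⟩

theorem statement0 (n : ℕ) (P : Polynomial ℂ) (hP : P.natDegree = n)
    (a α β : ℂ) (ha : ‖a‖ ≤ 1) (hα : ‖α‖ ≤ 1) (hβ : ‖β‖ ≤ 1)
    (R : ℝ) (hR : 1 ≤ R) (z : ℂ) (hz : 1 ≤ ‖z‖) :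
    ‖smirnov n a P ((R : ℂ) * z) - α * smirnov n a P z
        + β * (((((R + 1) / 2) ^ n - ‖α‖ : ℝ)) : ℂ) * smirnov n a P z‖
      ≤ ‖(R : ℂ) ^ n - α + β * (((((R + 1) / 2) ^ n - ‖α‖ : ℝ)) : ℂ)‖
        * ((n : ℝ) * ‖z‖ ^ (n - 1)) * maxCircle P := by
  rcases n with _ | n
  · have hd : P.derivative = 0 := derivative_of_natDegree_zero hP
    simp [smirnov, hd]
  · have hc : 1 ≤ ((R + 1) / 2) ^ (n + 1) := one_le_pow₀ (by linarith)
    have hB : 0 ≤ ((R + 1) / 2) ^ (n + 1) - ‖α‖ := by linarith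
    have hw : ‖α - β * ((((R + 1) / 2) ^ (n + 1) - ‖α‖ : ℝ) : ℂ)‖ ≤ ((R + 1) / 2) ^ (n + 1) := by
      refine (norm_sub_le _ _).trans ?_
      rw [norm_mul, Complex.norm_of_nonneg hB]
      nlinarith
    have h := norm_eval_mul_sub_le_succ_of_le (natDegree_smirnovPoly_le a hP.le)
      (M := (n + 1 : ℕ) * maxCircle P) (fun w hw => by
        rw [eval_smirnovPoly]
        exact norm_smirnov_le hP.le (fun _ => norm_eval_le_maxCircle P) ha hw) hR hz hw
    simp only [eval_smirnovPoly] at h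
    rw [Nat.add_sub_cancel]
    convert h using 1
    · congr 1
      ring
    · rw [← sub_add]
      ring
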